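/- The Lawvere Laplacian is a Q-functor: for a network sheaf/cosheaf pair F on a finite simple undirected graph G = (V,E) with stalks weighted lattices, restriction Q-functors F_{v◁e} and extension Q-functors F̄_{e▷v}, and a weighting W : V × V → Q, the operator L_W on C⁰F satisfies ⨅_{v∈V} hom_{Fv}(x_v, y_v) ≤ ⨅_{v∈V} hom_{Fv}((L_W x)_v, (L_W y)_v) for all x, y ∈ C⁰F, i.e. hom_{C⁰F}(x,y) ≤ hom_{C⁰F}(L_W x, L_W y). -/

import Mathlib

/- `Q` is a commutative unital quantale: `[CommMonoid Q] [CompleteLattice Q] [IsQuantale Q]`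
(Mathlib's `IsQuantale` says multiplication distributes over arbitrary suprema).
Semicartesianness (`∀ p q, p * q ≤ p ⊓ q`) is taken as an explicit hypothesis where needed. -/

universe u v w

/-- The internal hom `[p,q] := ⨆ {r | p·r ≤ q}` of a quantale. -/
def qhom {Q : Type v} [CompleteLattice Q] [Mul Q] (p q : Q) : Q := sSup {r | p * r ≤ q}

section QCat

variable {Q : Type v} [CompleteLattice Q] [CommMonoid Q] {A : Type u}

/-- A `Q`-category structure on `A` given by a `Q`-valued hom. -/
structure IsQCategory (hom : A → A → Q) : Prop where
  hom_self : ∀ x, hom x x = 1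
  comp : ∀ x y z, hom x y * hom y z ≤ hom x z

/-- `m` is the meet of `S` weighted by `W`. -/
def IsWeightedMeet (hom : A → A → Q) {ι : Type w} (S : ι → A) (W : ι → Q) (m : A) : Prop :=
  ∀ x, hom x m = ⨅ c, qhom (W c) (hom x (S c))

/-- `j` is the join of `S` weighted by `W`. -/
def IsWeightedJoin (hom : A → A → Q) {ι : Type w} (S : ι → A) (W : ι → Q) (j : A) : Prop :=
  ∀ x, hom j x = ⨅ c, qhom (W c) (hom (S c) x)

/-- The `Q`-category has all weighted meets. -/
def HasAllWeightedMeets (hom : A → A → Q) : Prop :=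
  ∀ (ι : Type u) (S : ι → A) (W : ι → Q), ∃ m, IsWeightedMeet hom S W m

/-- The `Q`-category has all weighted joins. -/
def HasAllWeightedJoins (hom : A → A → Q) : Prop :=
  ∀ (ι : Type u) (S : ι → A) (W : ι → Q), ∃ j, IsWeightedJoin hom S W j

end QCat

section Lap

variable (Q : Type v) [CompleteLattice Q] [CommMonoid Q]

/-- A network sheaf/cosheaf pair on a finite simple undirected graph `G = (V,E)`:
weighted-lattice stalks `Fv`, `Fe` over vertices and edges, restriction `Q`-functors
`F_{v◁e} : Fv → Fe` and extension `Q`-functors `F̄_{e▷v} : Fe → Fv` for each incidence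
`v ◁ e` (i.e. `v ∈ ∂e`). -/
structure LapSetup where
  /-- vertices -/
  V : Type u
  /-- edges -/
  E : Type u
  finV : Finite V
  finE : Finite E
  /-- `incid e v` means `v ◁ e`, i.e. `v ∈ ∂e` -/
  incid : E → V → Prop
  /-- every edge has exactly two distinct endpoints -/
  two_ends : ∀ e : E, ∃ v w : V, v ≠ w ∧ ∀ u, incid e u ↔ (u = v ∨ u = w)
  /-- the graph is simple: an edge is determined by its endpoints -/
  simple : ∀ e e' : E, (∀ v, incid e v ↔ incid e' v) → e = e'
  /-- vertex stalks -/
  Fv : V → Type u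
  /-- edge stalks -/
  Fe : E → Type u
  homV : ∀ v, Fv v → Fv v → Q
  homE : ∀ e, Fe e → Fe e → Q
  catV : ∀ v, IsQCategory (homV v)
  catE : ∀ e, IsQCategory (homE e)
  meetsV : ∀ v, HasAllWeightedMeets (homV v)
  joinsV : ∀ v, HasAllWeightedJoins (homV v)
  meetsE : ∀ e, HasAllWeightedMeets (homE e)
  joinsE : ∀ e, HasAllWeightedJoins (homE e)
  /-- restriction `F_{v◁e} : Fv → Fe` -/
  res : ∀ {e v}, incid e v → Fv v → Fe e
  /-- extension `F̄_{e▷v} : Fe → Fv` -/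
  ext : ∀ {e v}, incid e v → Fe e → Fv v
  res_functor : ∀ {e v} (h : incid e v) (a b : Fv v), homV v a b ≤ homE e (res h a) (res h b)
  ext_functor : ∀ {e v} (h : incid e v) (a b : Fe e), homE e a b ≤ homV v (ext h a) (ext h b)

variable {Q}

/-- 0-cochains `C⁰F = ∏_v Fv`. -/
abbrev Cochain (D : LapSetup Q) : Type u := ∀ v : D.V, D.Fv v

/-- The hom of the product `Q`-category `C⁰F`. -/
def C0hom (D : LapSetup Q) (x y : Cochain D) : Q := ⨅ v, D.homV v (x v) (y v)

/-- The index of the neighborhood family at `v`: pairs `(e, w)` with `v ◁ e ▷ w` and `w ≠ v`. -/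
def NbIdx (D : LapSetup Q) (v : D.V) : Type u :=
  {p : D.E × D.V // D.incid p.1 v ∧ D.incid p.1 p.2 ∧ p.2 ≠ v}

/-- `L` is a Lawvere Laplacian for `D` weighted by `W`: for every cochain `x` and vertex `v`,
`(L x)_v` is the meet of the family `F̄_{e▷v} (F_{w◁e} x_w)` (over `w ∈ N_v`, `∂e = {v,w}`)
weighted by `W(v,-)`. -/
def IsLawvereLaplacian (D : LapSetup Q) (W : D.V → D.V → Q)
    (L : Cochain D → Cochain D) : Prop :=
  ∀ (x : Cochain D) (v : D.V),
    IsWeightedMeet (D.homV v)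
      (fun p : NbIdx D v => D.ext p.2.1 (D.res p.2.2.1 (x p.1.2)))
      (fun p => W v p.1.2) (L x v)

/-- The Laplacian data is `ε`-fuzzy: each restriction/extension pair `F_{v◁e} ⊣_ε F̄_{e▷v}`
is an `ε`-fuzzy adjunction. -/
def IsFuzzyLap (D : LapSetup Q) (ε : Q) : Prop :=
  ∀ {e : D.E} {v : D.V} (h : D.incid e v) (a : D.Fv v) (b : D.Fe e),
    ε ≤ qhom (D.homE e (D.res h a) b) (D.homV v a (D.ext h b)) ∧
    ε ≤ qhom (D.homV v a (D.ext h b)) (D.homE e (D.res h a) b)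

/-- The Laplacian data is crisp: each restriction/extension pair is a genuine `Q`-adjunction. -/
def IsCrispLap (D : LapSetup Q) : Prop :=
  ∀ {e : D.E} {v : D.V} (h : D.incid e v) (a : D.Fv v) (b : D.Fe e),
    D.homE e (D.res h a) b = D.homV v a (D.ext h b)

/-- `x` is a `W`-fuzzy global section. -/
def IsGlobalSection (D : LapSetup Q) (W : D.V → D.V → Q) (x : Cochain D) : Prop :=
  ∀ {e : D.E} {v w : D.V} (hv : D.incid e v) (hw : D.incid e w), v ≠ w →
    W v w ≤ D.homE e (D.res hv (x v)) (D.res hw (x w))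

end Lap

/-- The internal hom is right adjoint to multiplication. -/
theorem le_qhom_iff {Q : Type v} [CompleteLattice Q] [CommMonoid Q] [IsQuantale Q] {p q r : Q} :
    r ≤ qhom p q ↔ p * r ≤ q := by
  refine ⟨fun h => (mul_le_mul_right h p).trans ?_, fun h => le_sSup h⟩
  rw [qhom, IsQuantale.mul_sSup_distrib]
  exact iSup₂_le fun _ h => h

/-- The weights bound the homs from a weighted meet to the members of its family. -/
theorem IsWeightedMeet.weight_le {Q : Type v} [CompleteLattice Q] [CommMonoid Q] [IsQuantale Q]
    {A : Type u} {hom : A → A → Q} (hA : IsQCategory hom) {ι : Type w} {S : ι → A} {W : ι → Q}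
    {m : A} (hm : IsWeightedMeet hom S W m) (c : ι) : W c ≤ hom m (S c) := by
  have h : (1 : Q) ≤ qhom (W c) (hom m (S c)) := by
    rw [← hA.hom_self m, hm m]
    exact iInf_le _ c
  simpa using le_qhom_iff.1 h

/-- Weighted meets are functorial in the family. -/
theorem IsWeightedMeet.le_hom {Q : Type v} [CompleteLattice Q] [CommMonoid Q] [IsQuantale Q]
    {A : Type u} {hom : A → A → Q} (hA : IsQCategory hom) {ι : Type w} {S T : ι → A} {W : ι → Q}
    {m n : A} (hm : IsWeightedMeet hom S W m) (hn : IsWeightedMeet hom T W n) {r : Q}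
    (hr : ∀ c, r ≤ hom (S c) (T c)) : r ≤ hom m n := by
  rw [hn m]
  exact le_iInf fun c => le_qhom_iff.2 <|
    (mul_le_mul' (hm.weight_le hA c) (hr c)).trans (hA.comp _ _ _)

/-- The Lawvere Laplacian is a `Q`-functor:
`hom_{C⁰F}(x,y) ≤ hom_{C⁰F}(L_W x, L_W y)`. -/
theorem lawvere_laplacian_is_functor
    {Q : Type v} [CompleteLattice Q] [CommMonoid Q] [IsQuantale Q]
    (hsc : ∀ p q : Q, p * q ≤ p ⊓ q)
    (D : LapSetup Q) (W : D.V → D.V → Q) (L : Cochain D → Cochain D)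
    (hL : IsLawvereLaplacian D W L) (x y : Cochain D) :
    C0hom D x y ≤ C0hom D (L x) (L y) := by
  refine le_iInf fun v => (hL x v).le_hom (D.catV v) (hL y v) fun p => ?_
  exact (iInf_le _ p.1.2).trans ((D.res_functor _ _ _).trans (D.ext_functor _ _ _))
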